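/- Under Assumption 1, AV(X) is the smallest set that fully explains Test(X): for every finite set X, Test(AV(X)) = Test(X), and for every subset Y ⊆ X with Test(Y) = Test(X) one has AV(X) ⊆ Y. Hence AV(X) is the least element (with respect to inclusion) of the family {Y ⊆ X : Test(Y) = Test(X)}. -/

import Mathlib

variable {α : Type*} [DecidableEq α]

/-- `x` is a benign element of `X`: adding it to any subset of `X` does not
change the test value. -/
def Benign (Test : Finset α → ℝ) (x : α) (X : Finset α) : Prop :=
  ∀ Y ⊆ X, Test Y = Test (Y ∪ {x})

open Classical in
/-- The set of all variable (non-benign) elements of `X`. -/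
noncomputable def AV (Test : Finset α → ℝ) (X : Finset α) : Finset α :=
  X.filter (fun x => ¬ Benign Test x X)


/-- Adding a set of benign elements of `X` to a subset of `X` does not change the test value. -/
theorem test_union_of_forall_benign {Test : Finset α → ℝ} {X Y S : Finset α}
    (hY : Y ⊆ X) (hS : S ⊆ X) (hB : ∀ x ∈ S, Benign Test x X) :
    Test (Y ∪ S) = Test Y := by
  induction S using Finset.induction_on with
  | empty => simp
  | insert a S _ ih =>
    obtain ⟨ha, hS⟩ := Finset.insert_subset_iff.mp hS
    have hstep := hB a (Finset.mem_insert_self a S) (Y ∪ S) (Finset.union_subset hY hS)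
    rw [Finset.union_insert, Finset.insert_eq, Finset.union_comm {a}, ← hstep]
    exact ih hS fun x hx => hB x (Finset.mem_insert_of_mem hx)

theorem mem_AV {Test : Finset α → ℝ} {X : Finset α} {x : α} :
    x ∈ AV Test X ↔ x ∈ X ∧ ¬ Benign Test x X := by
  simp [AV]

theorem AV_subset (Test : Finset α → ℝ) (X : Finset α) : AV Test X ⊆ X :=
  fun _ hx => (mem_AV.mp hx).1

theorem test_AV (Test : Finset α → ℝ) (X : Finset α) : Test (AV Test X) = Test X := by
  have hB : ∀ x ∈ X \ AV Test X, Benign Test x X := by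
    intro x hx
    by_contra h
    obtain ⟨hxX, hxAV⟩ := Finset.mem_sdiff.mp hx
    exact hxAV (mem_AV.mpr ⟨hxX, h⟩)
  rw [← test_union_of_forall_benign (AV_subset Test X) Finset.sdiff_subset hB,
    Finset.union_sdiff_of_subset (AV_subset Test X)]

/-- Under Assumption 1, `AV X` is the smallest subset of `X` fully
explaining `Test X`: it has the same test value as `X`, and it is contained
in every subset of `X` with the same test value as `X`. -/
theorem AV_least_explaining (Test : Finset α → ℝ)
    (h1 : ∀ X Y : Finset α, Test X = Test Y ↔ AV Test X = AV Test Y)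
    (X : Finset α) :
    Test (AV Test X) = Test X ∧
      ∀ Y ⊆ X, Test Y = Test X → AV Test X ⊆ Y := by
  refine ⟨test_AV Test X, fun Y _ h => ?_⟩
  rw [← (h1 Y X).mp h]
  exact AV_subset Test Y
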